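/- Let q be a conservative Q-function satisfying Assumption LB. Then for all u ∈ [T₀,T₁), x ∈ X, and q-bounded sets B ∈ 𝓑(X), the function P̄ satisfies, for all t ∈ (u,T₁): P̄(u,x;t,B) = 1{x∈B} − ∫_u^t ∫_B q(y,w) P̄(u,x;w,dy) dw + ∫_u^t ∫_X q(y,w,B∖{y}) P̄(u,x;w,dy) dw. -/

import Mathlib

open MeasureTheory Set Filter Topology
open scoped ENNReal

noncomputable section

/-- A conservative `Q`-function on the state space `X` with time horizon `[T₀, T₁)`,
`T₁ ≤ +∞`.  It is encoded by the kernel `qp x t = q(x, t, · \ {x})`; since `q` is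
conservative, the signed measure `q(x,t,·)` is recovered as
`q(x,t,B) = qp x t B - qp x t univ · 1{x ∈ B}`, so that `q(x,t,X) = 0`. -/
structure ConsQFun (X : Type*) [MeasurableSpace X] (T₀ : ℝ) (T₁ : EReal) where
  qp : X → ℝ → Measure X
  fin : ∀ x t, qp x t Set.univ ≠ ⊤
  diag : ∀ x t, qp x t {x} = 0
  meas : ∀ B : Set X, MeasurableSet B → Measurable fun p : X × ℝ => qp p.1 p.2 B

namespace ConsQFun

variable {X : Type*} [MeasurableSpace X] {T₀ : ℝ} {T₁ : EReal}

/-- The jump rate `q(x,t) = q(x, t, X \ {x})`, as a real number. -/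
def qrate (Q : ConsQFun X T₀ T₁) (x : X) (t : ℝ) : ℝ := (Q.qp x t Set.univ).toReal

/-- `q̄(x) = sup_{t ∈ [T₀,T₁)} q(x,t)`, computed in `ℝ≥0∞`. -/
def qbar (Q : ConsQFun X T₀ T₁) (x : X) : ℝ≥0∞ :=
  ⨆ t ∈ {t : ℝ | T₀ ≤ t ∧ (t : EReal) < T₁}, Q.qp x t Set.univ

/-- Assumption (Feller): there are Borel sets `Bₙ ↑ X` with `sup_{x ∈ Bₙ} q̄(x) < n`
(for `n = 1, 2, …`; here reindexed by `n ↦ n + 1`). -/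
def AssumptionFeller (Q : ConsQFun X T₀ T₁) : Prop :=
  ∃ B : ℕ → Set X, (∀ n, MeasurableSet (B n)) ∧ (∀ n, B n ⊆ B (n + 1)) ∧
    (⋃ n, B n) = Set.univ ∧ ∀ n : ℕ, (⨆ x ∈ B n, Q.qbar x) < (n : ℝ≥0∞) + 1

/-- Assumption (LB): `q̄(x) < ∞` for every `x`. -/
def AssumptionLB (Q : ConsQFun X T₀ T₁) : Prop := ∀ x, Q.qbar x < ⊤

/-- Assumption (ALB): `sup_{t ∈ [T₀,s)} q(x,t) < ∞` for every `x` and `s ∈ (T₀,T₁)`. -/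
def AssumptionALB (Q : ConsQFun X T₀ T₁) : Prop :=
  ∀ (x : X) (s : ℝ), T₀ < s → (s : EReal) < T₁ →
    (⨆ t ∈ Set.Ico T₀ s, Q.qp x t Set.univ) < ⊤

/-- Assumption (L1): `∫_{T₀}^s q(x,t) dt < ∞` for every `x` and `s ∈ (T₀,T₁)`. -/
def AssumptionL1 (Q : ConsQFun X T₀ T₁) : Prop :=
  ∀ (x : X) (s : ℝ), T₀ < s → (s : EReal) < T₁ →
    ∫⁻ t in Set.Ico T₀ s, Q.qp x t Set.univ < ⊤

/-- A set `B` is `(q,s)`-bounded if `q(x,t)` is bounded on `B × [T₀, s)`; for `s = T₁`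
this is the notion of a `q`-bounded set. -/
def QBddOn (Q : ConsQFun X T₀ T₁) (s : EReal) (B : Set X) : Prop :=
  ∃ C : ℝ≥0∞, C ≠ ⊤ ∧ ∀ x ∈ B, ∀ t : ℝ, T₀ ≤ t → (t : EReal) < s → Q.qp x t Set.univ ≤ C

/-- Feller's iterates: `P̄⁽⁰⁾(u,x;t,B) = 1{x∈B} e^{-∫_u^t q(x,s) ds}` and
`P̄⁽ⁿ⁾(u,x;t,B) = ∫_u^t ∫_X e^{-∫_u^w q(x,θ) dθ} P̄⁽ⁿ⁻¹⁾(w,y;t,B) q(x,w,dy∖{x}) dw`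
(the measure `q(x,w, ·∖{x})` is `Q.qp x w`, which has no atom at `x`). -/
def PbarN (Q : ConsQFun X T₀ T₁) : ℕ → ℝ → X → ℝ → Set X → ℝ≥0∞
  | 0 => fun u x t B =>
      B.indicator (fun _ => ENNReal.ofReal (Real.exp (-(∫ s in u..t, Q.qrate x s)))) x
  | n + 1 => fun u x t B =>
      ∫⁻ w in Set.Ioo u t,
        ∫⁻ y, ENNReal.ofReal (Real.exp (-(∫ θ in u..w, Q.qrate x θ))) * Q.PbarN n w y t B
          ∂(Q.qp x w)

/-- The transition function `P̄(u,x;t,B) = Σ_{n=0}^∞ P̄⁽ⁿ⁾(u,x;t,B)`. -/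
def Pbar (Q : ConsQFun X T₀ T₁) (u : ℝ) (x : X) (t : ℝ) (B : Set X) : ℝ≥0∞ :=
  ∑' n, Q.PbarN n u x t B

/-- `P̄` as a real-valued function. -/
def PbarR (Q : ConsQFun X T₀ T₁) (u : ℝ) (x : X) (t : ℝ) (B : Set X) : ℝ :=
  (Q.Pbar u x t B).toReal

end ConsQFun

/-- A real-valued function `f` is absolutely continuous on a set `s ⊆ ℝ`: for every `ε > 0`
there is `δ > 0` such that for every finite collection of nonoverlapping intervals
`(aᵢ, bᵢ)` with endpoints in `s` and total length `< δ`, `Σ |f(bᵢ) - f(aᵢ)| < ε`. -/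
def AbsContinuousOn (f : ℝ → ℝ) (s : Set ℝ) : Prop :=
  ∀ ε > (0 : ℝ), ∃ δ > (0 : ℝ), ∀ (n : ℕ) (a b : ℕ → ℝ),
    (∀ i, i < n → a i ∈ s ∧ b i ∈ s ∧ a i ≤ b i) →
    (∀ i, i < n → ∀ j, j < n → i ≠ j → Disjoint (Set.Ioo (a i) (b i)) (Set.Ioo (a j) (b j))) →
    (∑ i ∈ Finset.range n, (b i - a i)) < δ →
    (∑ i ∈ Finset.range n, |f (b i) - f (a i)|) < ε


theorem ftc_exp (q : ℝ → ℝ) (hq : Measurable q) (h0 : ∀ s, 0 ≤ q s) (K : NNReal) (u t : ℝ)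
    (hut : u ≤ t) (hK : ∀ s ∈ Icc u t, q s ≤ K) :
    ENNReal.ofReal (Real.exp (-∫ s in u..t, q s)) +
      ∫⁻ w in Ioo u t, ENNReal.ofReal (Real.exp (-∫ s in u..w, q s)) * ENNReal.ofReal (q w)
      = 1 := by
  have hint : IntegrableOn q (Icc u t) := by
    refine Measure.integrableOn_of_bounded (M := K) (by simp) hq.aestronglyMeasurable ?_
    filter_upwards [ae_restrict_mem measurableSet_Icc] with s hs
    rw [Real.norm_of_nonneg (h0 s)]; exact hK s hs
  have hii : ∀ a ∈ Icc u t, ∀ b ∈ Icc u t, IntervalIntegrable q volume a b := by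
    intro a ha b hb
    rw [intervalIntegrable_iff]
    exact hint.mono_set (uIoc_subset_uIcc.trans (uIcc_subset_Icc ha hb))
  have hu : u ∈ Icc u t := ⟨le_rfl, hut⟩
  have ht : t ∈ Icc u t := ⟨hut, le_rfl⟩
  have hpos : ∀ w ∈ Icc u t, 0 ≤ ∫ s in u..w, q s := fun w hw =>
    intervalIntegral.integral_nonneg hw.1 (fun s _ => h0 s)
  set g : ℝ → ℝ := fun w => Real.exp (-∫ s in u..w, q s) with hg
  have hmono : ∀ a ∈ Icc u t, ∀ b ∈ Icc u t, a ≤ b →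
      g b ≤ g a ∧ g a - g b ≤ K * (b - a) := by
    intro a ha b hb hab
    have h1 : (∫ s in u..a, q s) + (∫ s in a..b, q s) = ∫ s in u..b, q s :=
      intervalIntegral.integral_add_adjacent_intervals (hii u hu a ha) (hii a ha b hb)
    have h2 : 0 ≤ ∫ s in a..b, q s := intervalIntegral.integral_nonneg hab (fun s _ => h0 s)
    have h3 : (∫ s in a..b, q s) ≤ K * (b - a) := by
      have := intervalIntegral.integral_mono_on hab (hii a ha b hb)
        (intervalIntegrable_const (c := (K : ℝ)))
        (fun s hs => hK s ⟨ha.1.trans hs.1, hs.2.trans hb.2⟩)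
      simpa [mul_comm] using this
    have h4 : g b = g a * Real.exp (-∫ s in a..b, q s) := by
      simp only [hg]; rw [← Real.exp_add, ← h1]; congr 1; ring
    have h5 := Real.add_one_le_exp (-∫ s in a..b, q s)
    have h6 : Real.exp (-∫ s in a..b, q s) ≤ 1 := Real.exp_le_one_iff.2 (by linarith)
    have h7 : g a ≤ 1 := Real.exp_le_one_iff.2 (by linarith [hpos a ha])
    have h8 : 0 < g a := Real.exp_pos _
    constructor
    · rw [h4]; nlinarith
    · rw [h4]; nlinarith
  have hlip : LipschitzOnWith K g (uIcc u t) := by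
    rw [uIcc_of_le hut]
    refine LipschitzOnWith.of_dist_le_mul fun a ha b hb => ?_
    rw [Real.dist_eq, Real.dist_eq]
    rcases le_total a b with hab | hab
    · have := hmono a ha b hb hab
      rw [abs_of_nonneg (by linarith), abs_of_nonpos (by linarith)]; linarith
    · have := hmono b hb a ha hab
      rw [abs_of_nonpos (by linarith), abs_of_nonneg (by linarith)]; linarith
  have hac := hlip.absolutelyContinuousOnInterval
  have hI := hac.integral_deriv_eq_sub
  have hD := hac.intervalIntegrable_deriv
  have hder : ∀ᵐ w, w ∈ uIcc u t → deriv g w = - (g w * q w) := by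
    filter_upwards [(hii u hu t ht).ae_hasDerivAt_integral] with w hw hwm
    have := ((hw hwm u (by simp)).neg).exp
    simpa [hg] using this.deriv
  have hae : ∀ᵐ w ∂(volume.restrict (Ioo u t)), deriv g w = - (g w * q w) := by
    rw [ae_restrict_iff' measurableSet_Ioo]
    filter_upwards [hder] with w hw hm
    exact hw (by rw [uIcc_of_le hut]; exact Ioo_subset_Icc_self hm)
  rw [intervalIntegral.integral_of_le hut, integral_Ioc_eq_integral_Ioo,
    integral_congr_ae hae, integral_neg] at hI
  have hD2 : IntegrableOn (fun w => g w * q w) (Ioo u t) := by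
    rw [intervalIntegrable_iff_integrableOn_Ioo_of_le hut] at hD
    have := (hD.congr hae).neg
    refine this.congr (Eventually.of_forall fun w => ?_)
    simp
  have hL : ∫⁻ w in Ioo u t, ENNReal.ofReal (g w) * ENNReal.ofReal (q w)
      = ENNReal.ofReal (∫ w in Ioo u t, g w * q w) := by
    rw [ofReal_integral_eq_lintegral_ofReal hD2
      (Eventually.of_forall fun w => mul_nonneg (Real.exp_pos _).le (h0 w))]
    refine lintegral_congr fun w => ?_
    rw [ENNReal.ofReal_mul (Real.exp_pos _).le]
  change ENNReal.ofReal (g t) + ∫⁻ w in Ioo u t, ENNReal.ofReal (g w) * ENNReal.ofReal (q w) = 1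
  rw [hL, ← ENNReal.ofReal_add (Real.exp_pos _).le
    (integral_nonneg fun w => mul_nonneg (Real.exp_pos _).le (h0 w))]
  have : g u = 1 := by simp [hg]
  rw [show g t + ∫ w in Ioo u t, g w * q w = 1 by linarith]
  simp

namespace ConsQFun

variable {X : Type*} [MeasurableSpace X] {T₀ : ℝ} {T₁ : EReal}

/-- Survival factor. -/
def EE (Q : ConsQFun X T₀ T₁) (u t : ℝ) (x : X) : ℝ≥0∞ :=
  ENNReal.ofReal (Real.exp (-(∫ s in u..t, Q.qrate x s)))

theorem measurable_qrate (Q : ConsQFun X T₀ T₁) :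
    Measurable fun p : X × ℝ => Q.qrate p.1 p.2 :=
  (Q.meas univ MeasurableSet.univ).ennreal_toReal

theorem EE_add (Q : ConsQFun X T₀ T₁) (hLB : Q.AssumptionLB) (u t : ℝ) (x : X)
    (hu : T₀ ≤ u) (hut : u ≤ t) (ht : (t : EReal) < T₁) :
    Q.EE u t x + ∫⁻ w in Ioo u t, Q.EE u w x * Q.qp x w univ = 1 := by
  have h := ftc_exp (Q.qrate x) (Q.measurable_qrate.comp measurable_prodMk_left)
    (fun s => ENNReal.toReal_nonneg) (Q.qbar x).toNNReal u t hut (by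
      intro s hs
      have h1 : Q.qp x s univ ≤ Q.qbar x := by
        refine le_iSup₂_of_le s ⟨hu.trans hs.1, lt_of_le_of_lt ?_ ht⟩ le_rfl
        exact_mod_cast hs.2
      exact ENNReal.toReal_mono (hLB x).ne h1)
  rw [← h]
  congr 1
  refine lintegral_congr fun w => ?_
  simp only [EE, qrate]
  rw [ENNReal.ofReal_toReal (Q.fin x w)]

theorem measurable_EE (Q : ConsQFun X T₀ T₁) :
    Measurable fun p : ℝ × ℝ × X => Q.EE p.1 p.2.1 p.2.2 := by
  have key : ∀ a b : ℝ × ℝ × X → ℝ, Measurable a → Measurable b →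
      Measurable fun p : ℝ × ℝ × X => ∫ s in Ioc (a p) (b p), Q.qrate p.2.2 s := by
    intro a b ha hb
    have : (fun p : ℝ × ℝ × X => ∫ s in Ioc (a p) (b p), Q.qrate p.2.2 s) =
        fun p => ∫ s, {r : (ℝ × ℝ × X) × ℝ | a r.1 < r.2 ∧ r.2 ≤ b r.1}.indicator
          (fun r => Q.qrate r.1.2.2 r.2) (p, s) := by
      funext p
      rw [← integral_indicator measurableSet_Ioc]
      rfl
    rw [this]
    refine StronglyMeasurable.measurable (StronglyMeasurable.integral_prod_right' ?_)
    refine Measurable.stronglyMeasurable ?_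
    refine Measurable.indicator ?_ ?_
    · exact Q.measurable_qrate.comp (f := fun r : (ℝ × ℝ × X) × ℝ => (r.1.2.2, r.2))
        (by fun_prop)
    · exact (measurableSet_lt (f := fun r : (ℝ × ℝ × X) × ℝ => a r.1) (g := fun r => r.2)
          (by fun_prop) (by fun_prop)).inter
        (measurableSet_le (f := fun r : (ℝ × ℝ × X) × ℝ => r.2) (g := fun r => b r.1)
          (by fun_prop) (by fun_prop))
  unfold EE
  refine ENNReal.measurable_ofReal.comp (Real.measurable_exp.comp (Measurable.neg ?_))
  exact (key (fun p => p.1) (fun p => p.2.1) (by fun_prop) (by fun_prop)).sub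
    (key (fun p => p.2.1) (fun p => p.1) (by fun_prop) (by fun_prop))

/-- Measurability of integrals against `qp`. -/
theorem measurable_lintegral_qp (Q : ConsQFun X T₀ T₁) {P : Type*} [MeasurableSpace P]
    (a : P → X) (b : P → ℝ) (ha : Measurable a) (hb : Measurable b)
    (g : P × X → ℝ≥0∞) (hg : Measurable g) :
    Measurable fun p => ∫⁻ y, g (p, y) ∂(Q.qp (a p) (b p)) := by
  have hm : ∀ C, MeasurableSet C → Measurable fun p => Q.qp (a p) (b p) C := fun C hC =>
    (Q.meas C hC).comp (ha.prodMk hb)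
  let η : ProbabilityTheory.Kernel P X :=
    { toFun := fun p => (Q.qp (a p) (b p) univ)⁻¹ • Q.qp (a p) (b p)
      measurable' := by
        refine Measure.measurable_of_measurable_coe _ fun C hC => ?_
        simp only [Measure.smul_apply, smul_eq_mul]
        exact (hm univ .univ).inv.mul (hm C hC) }
  have hη : ∀ p, η p = (Q.qp (a p) (b p) univ)⁻¹ • Q.qp (a p) (b p) := fun p => rfl
  have : ProbabilityTheory.IsFiniteKernel η := by
    refine ⟨⟨1, ENNReal.one_lt_top, fun p => ?_⟩⟩
    rw [hη]
    simp only [Measure.smul_apply, smul_eq_mul]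
    exact ENNReal.inv_mul_le_one _
  have h1 : Measurable fun p => ∫⁻ y, g (p, y) ∂(η p) := hg.lintegral_kernel_prod_right'
  have h2 := (hm univ .univ).mul h1
  convert h2 using 1
  funext p
  simp only [Pi.mul_apply, hη, lintegral_smul_measure, smul_eq_mul]
  by_cases h0 : Q.qp (a p) (b p) univ = 0
  · rw [Measure.measure_univ_eq_zero.1 h0]; simp
  · rw [← mul_assoc, ENNReal.mul_inv_cancel h0 (Q.fin _ _), one_mul]

/-- The functional `∫ f(t,z) P⁽ⁿ⁾(u,x;t,dz)`. -/
def Lf (Q : ConsQFun X T₀ T₁) (f : ℝ × X → ℝ≥0∞) : ℕ → ℝ → X → ℝ → ℝ≥0∞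
  | 0 => fun u x t => Q.EE u t x * f (t, x)
  | n + 1 => fun u x t =>
      ∫⁻ w in Ioo u t, ∫⁻ y, Q.EE u w x * Q.Lf f n w y t ∂(Q.qp x w)

theorem measurable_Lf (Q : ConsQFun X T₀ T₁) (f : ℝ × X → ℝ≥0∞) (hf : Measurable f) (n : ℕ) :
    Measurable fun p : ℝ × X × ℝ => Q.Lf f n p.1 p.2.1 p.2.2 := by
  induction n with
  | zero =>
    simp only [Lf]
    exact (Q.measurable_EE.comp (f := fun p : ℝ × X × ℝ => (p.1, p.2.2, p.2.1))
      (by fun_prop)).mul (hf.comp (by fun_prop))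
  | succ n ih =>
    simp only [Lf]
    have h1 : Measurable fun r : (ℝ × X × ℝ) × ℝ =>
        ∫⁻ y, Q.EE r.1.1 r.2 r.1.2.1 * Q.Lf f n r.2 y r.1.2.2 ∂(Q.qp r.1.2.1 r.2) := by
      refine Q.measurable_lintegral_qp (fun r : (ℝ × X × ℝ) × ℝ => r.1.2.1) (fun r => r.2)
        (by fun_prop) (by fun_prop)
        (fun s => Q.EE s.1.1.1 s.1.2 s.1.1.2.1 * Q.Lf f n s.1.2 s.2 s.1.1.2.2) ?_
      exact (Q.measurable_EE.comp
        (f := fun s : ((ℝ × X × ℝ) × ℝ) × X => (s.1.1.1, s.1.2, s.1.1.2.1)) (by fun_prop)).mul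
        (ih.comp (f := fun s : ((ℝ × X × ℝ) × ℝ) × X => (s.1.2, s.2, s.1.1.2.2)) (by fun_prop))
    have h2 : (fun p : ℝ × X × ℝ => ∫⁻ w in Ioo p.1 p.2.2,
        ∫⁻ y, Q.EE p.1 w p.2.1 * Q.Lf f n w y p.2.2 ∂(Q.qp p.2.1 w)) =
        fun p => ∫⁻ w, {r : (ℝ × X × ℝ) × ℝ | r.1.1 < r.2 ∧ r.2 < r.1.2.2}.indicator
          (fun r => ∫⁻ y, Q.EE r.1.1 r.2 r.1.2.1 * Q.Lf f n r.2 y r.1.2.2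
            ∂(Q.qp r.1.2.1 r.2)) (p, w) := by
      funext p
      rw [← lintegral_indicator measurableSet_Ioo]
      rfl
    rw [h2]
    refine Measurable.lintegral_prod_right' (h1.indicator ?_)
    exact (measurableSet_lt (f := fun r : (ℝ × X × ℝ) × ℝ => r.1.1) (g := fun r => r.2)
          (by fun_prop) (by fun_prop)).inter
        (measurableSet_lt (f := fun r : (ℝ × X × ℝ) × ℝ => r.2) (g := fun r => r.1.2.2)
          (by fun_prop) (by fun_prop))

theorem PbarN_eq (Q : ConsQFun X T₀ T₁) (B : Set X) (n : ℕ) : ∀ (u : ℝ) (x : X) (t : ℝ),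
    Q.PbarN n u x t B = Q.Lf (fun p => B.indicator 1 p.2) n u x t := by
  induction n with
  | zero =>
    intro u x t
    by_cases h : x ∈ B <;> simp [PbarN, Lf, EE, h]
  | succ n ih =>
    intro u x t
    simp only [PbarN, Lf, ih]
    rfl

theorem Lf_congr (Q : ConsQFun X T₀ T₁) (f g : ℝ × X → ℝ≥0∞) (t : ℝ)
    (h : ∀ z, f (t, z) = g (t, z)) (n : ℕ) : ∀ (u : ℝ) (x : X),
    Q.Lf f n u x t = Q.Lf g n u x t := by
  induction n with
  | zero => intro u x; simp only [Lf, h]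
  | succ n ih => intro u x; simp only [Lf, ih]

theorem measurable_Lf_y (Q : ConsQFun X T₀ T₁) (f : ℝ × X → ℝ≥0∞) (hf : Measurable f) (n : ℕ)
    (w t : ℝ) : Measurable fun y => Q.Lf f n w y t :=
  (Q.measurable_Lf f hf n).comp (f := fun y : X => (w, y, t)) (by fun_prop)

theorem measurable_Lf_inner (Q : ConsQFun X T₀ T₁) (f : ℝ × X → ℝ≥0∞) (hf : Measurable f)
    (n : ℕ) (u : ℝ) (x : X) (t : ℝ) :
    Measurable fun w => ∫⁻ y, Q.EE u w x * Q.Lf f n w y t ∂(Q.qp x w) := by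
  refine Q.measurable_lintegral_qp (fun _ : ℝ => x) (fun w => w) (by fun_prop) (by fun_prop)
    (fun s => Q.EE u s.1 x * Q.Lf f n s.1 s.2 t) ?_
  exact (Q.measurable_EE.comp (f := fun s : ℝ × X => (u, s.1, x)) (by fun_prop)).mul
    ((Q.measurable_Lf f hf n).comp (f := fun s : ℝ × X => (s.1, s.2, t)) (by fun_prop))

theorem Lf_add (Q : ConsQFun X T₀ T₁) (f g : ℝ × X → ℝ≥0∞) (hf : Measurable f)
    (n : ℕ) : ∀ (u : ℝ) (x : X) (t : ℝ),
    Q.Lf (f + g) n u x t = Q.Lf f n u x t + Q.Lf g n u x t := by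
  induction n with
  | zero => intro u x t; simp only [Lf, Pi.add_apply, mul_add]
  | succ n ih =>
    intro u x t
    simp only [Lf, ih, mul_add]
    rw [← lintegral_add_left (Q.measurable_Lf_inner f hf n u x t)]
    refine lintegral_congr fun w => ?_
    rw [lintegral_add_left ((Q.measurable_Lf_y f hf n w t).const_mul _)]

theorem Lf_const_mul (Q : ConsQFun X T₀ T₁) (f : ℝ × X → ℝ≥0∞) (hf : Measurable f) (c : ℝ≥0∞)
    (n : ℕ) : ∀ (u : ℝ) (x : X) (t : ℝ),
    Q.Lf (fun p => c * f p) n u x t = c * Q.Lf f n u x t := by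
  induction n with
  | zero => intro u x t; simp only [Lf]; ring
  | succ n ih =>
    intro u x t
    simp only [Lf, ih]
    rw [← lintegral_const_mul _ (Q.measurable_Lf_inner f hf n u x t)]
    refine lintegral_congr fun w => ?_
    rw [← lintegral_const_mul _ ((Q.measurable_Lf_y f hf n w t).const_mul _)]
    refine lintegral_congr fun y => ?_
    ring

theorem Lf_mono (Q : ConsQFun X T₀ T₁) (f g : ℝ × X → ℝ≥0∞) (h : f ≤ g)
    (n : ℕ) : ∀ (u : ℝ) (x : X) (t : ℝ), Q.Lf f n u x t ≤ Q.Lf g n u x t := by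
  induction n with
  | zero => intro u x t; exact mul_le_mul_right (h _) _
  | succ n ih =>
    intro u x t
    exact lintegral_mono fun w => lintegral_mono fun y => mul_le_mul_right (ih w y t) _

theorem Lf_iSup (Q : ConsQFun X T₀ T₁) (f : ℕ → ℝ × X → ℝ≥0∞) (hf : ∀ k, Measurable (f k))
    (hm : Monotone f) (n : ℕ) : ∀ (u : ℝ) (x : X) (t : ℝ),
    Q.Lf (fun p => ⨆ k, f k p) n u x t = ⨆ k, Q.Lf (f k) n u x t := by
  induction n with
  | zero => intro u x t; simp only [Lf, ENNReal.mul_iSup]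
  | succ n ih =>
    intro u x t
    simp only [Lf, ih]
    have hmono : ∀ w y, Monotone fun k => Q.EE u w x * Q.Lf (f k) n w y t := fun w y i j hij =>
      mul_le_mul_right (Q.Lf_mono _ _ (hm hij) n w y t) _
    rw [← lintegral_iSup (fun k => Q.measurable_Lf_inner (f k) (hf k) n u x t)
      (fun i j hij w => lintegral_mono fun y => hmono w y hij)]
    refine lintegral_congr fun w => ?_
    rw [← lintegral_iSup (fun k => (Q.measurable_Lf_y (f k) (hf k) n w t).const_mul _)
      (fun i j hij y => hmono w y hij)]
    refine lintegral_congr fun y => ?_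
    rw [ENNReal.mul_iSup]

theorem lintegral_eq_tsum_aux (Q : ConsQFun X T₀ T₁) (u : ℝ) (x : X) (w : ℝ) (μ : Measure X)
    (hμ : ∀ C : Set X, MeasurableSet C → μ C = Q.Pbar u x w C) (h : X → ℝ≥0∞)
    (hh : Measurable h) :
    ∫⁻ z, h z ∂μ = ∑' n, Q.Lf (fun p => h p.2) n u x w := by
  refine Measurable.ennreal_induction (motive := fun h : X → ℝ≥0∞ =>
    ∫⁻ z, h z ∂μ = ∑' n, Q.Lf (fun p => h p.2) n u x w) ?_ ?_ ?_ hh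
  · intro c s hs
    rw [lintegral_indicator_const hs, hμ s hs, Pbar, ← ENNReal.tsum_mul_left]
    refine tsum_congr fun n => ?_
    rw [Q.PbarN_eq, ← Q.Lf_const_mul (fun p => s.indicator 1 p.2) ((measurable_one.indicator hs).comp measurable_snd)]
    refine Q.Lf_congr _ _ _ (fun z => ?_) n u x
    by_cases hz : z ∈ s <;> simp [hz]
  · intro f g _ hf hg ihf ihg
    simp only [Pi.add_apply]
    rw [lintegral_add_left hf, ihf, ihg, ← ENNReal.tsum_add]
    refine tsum_congr fun n => ?_
    exact (Q.Lf_add (fun p => f p.2) (fun p => g p.2) (hf.comp measurable_snd) n u x w).symm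
  · intro f hf hm ih
    rw [lintegral_iSup hf hm]
    have h1 : ∀ n, Q.Lf (fun p : ℝ × X => ⨆ k, f k p.2) n u x w
        = ⨆ k, Q.Lf (fun p : ℝ × X => f k p.2) n u x w := fun n =>
      Q.Lf_iSup (fun k p => f k p.2) (fun k => (hf k).comp measurable_snd)
        (fun i j hij p => hm hij p.2) n u x w
    simp only [h1, ih]
    simp only [← lintegral_count]
    rw [lintegral_iSup (fun k => measurable_of_countable _)]
    intro i j hij n
    exact Q.Lf_mono _ _ (fun p => hm hij p.2) n u x w

theorem lintegral_eq_tsum (Q : ConsQFun X T₀ T₁) (u : ℝ) (x : X) (w : ℝ) (μ : Measure X)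
    (hμ : ∀ C : Set X, MeasurableSet C → μ C = Q.Pbar u x w C) (f : ℝ × X → ℝ≥0∞)
    (hf : Measurable f) :
    ∫⁻ z, f (w, z) ∂μ = ∑' n, Q.Lf f n u x w := by
  rw [Q.lintegral_eq_tsum_aux u x w μ hμ (fun z => f (w, z)) (hf.comp measurable_prodMk_left)]
  exact tsum_congr fun n => Q.Lf_congr (fun p => f (w, p.2)) f w (fun z => rfl) n u x

instance (Q : ConsQFun X T₀ T₁) (x : X) (t : ℝ) : IsFiniteMeasure (Q.qp x t) :=
  ⟨(Q.fin x t).lt_top⟩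

/-- Time-integrated functional. -/
def Gf (Q : ConsQFun X T₀ T₁) (f : ℝ × X → ℝ≥0∞) (n : ℕ) (u : ℝ) (x : X) (t : ℝ) : ℝ≥0∞ :=
  ∫⁻ v in Ioo u t, Q.Lf f n u x v

theorem Gf_succ (Q : ConsQFun X T₀ T₁) (f : ℝ × X → ℝ≥0∞) (hf : Measurable f) (n : ℕ)
    (u : ℝ) (x : X) (t : ℝ) :
    Q.Gf f (n + 1) u x t =
      ∫⁻ w in Ioo u t, ∫⁻ y, Q.EE u w x * Q.Gf f n w y t ∂(Q.qp x w) := by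
  have h1 : Measurable fun r : ℝ × ℝ =>
      ∫⁻ y, Q.EE u r.2 x * Q.Lf f n r.2 y r.1 ∂(Q.qp x r.2) := by
    refine Q.measurable_lintegral_qp (fun _ : ℝ × ℝ => x) (fun r => r.2) (by fun_prop)
      (by fun_prop) (fun s => Q.EE u s.1.2 x * Q.Lf f n s.1.2 s.2 s.1.1) ?_
    exact (Q.measurable_EE.comp (f := fun s : (ℝ × ℝ) × X => (u, s.1.2, x)) (by fun_prop)).mul
      ((Q.measurable_Lf f hf n).comp (f := fun s : (ℝ × ℝ) × X => (s.1.2, s.2, s.1.1))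
        (by fun_prop))
  set F : ℝ → ℝ → ℝ≥0∞ := fun v w =>
      ∫⁻ y, Q.EE u w x * Q.Lf f n w y v ∂(Q.qp x w) with hF
  have h2 : Measurable fun r : ℝ × ℝ => {r : ℝ × ℝ | u < r.2 ∧ r.2 < r.1 ∧ r.1 < t}.indicator
      (fun r => F r.1 r.2) r := by
    refine h1.indicator ?_
    exact (measurableSet_lt (f := fun r : ℝ × ℝ => u) (g := fun r => r.2)
          (by fun_prop) (by fun_prop)).inter
        ((measurableSet_lt (f := fun r : ℝ × ℝ => r.2) (g := fun r => r.1)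
          (by fun_prop) (by fun_prop)).inter
        (measurableSet_lt (f := fun r : ℝ × ℝ => r.1) (g := fun r => t)
          (by fun_prop) (by fun_prop)))
  have hL : Q.Gf f (n + 1) u x t = ∫⁻ v, ∫⁻ w,
      {r : ℝ × ℝ | u < r.2 ∧ r.2 < r.1 ∧ r.1 < t}.indicator (fun r => F r.1 r.2) (v, w) := by
    simp only [Gf, Lf]
    rw [← lintegral_indicator measurableSet_Ioo]
    refine lintegral_congr fun v => ?_
    by_cases hv : v ∈ Ioo u t
    · rw [indicator_of_mem hv, ← lintegral_indicator measurableSet_Ioo]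
      refine lintegral_congr fun w => ?_
      by_cases hw : w ∈ Ioo u v
      · rw [indicator_of_mem hw, indicator_of_mem (show (v, w) ∈ {r : ℝ × ℝ | u < r.2 ∧ r.2 < r.1 ∧ r.1 < t} from ⟨hw.1, hw.2, hv.2⟩)]
      · rw [indicator_of_notMem hw, indicator_of_notMem]
        rintro ⟨a, b, c⟩
        exact hw ⟨a, b⟩
    · rw [indicator_of_notMem hv]
      symm
      refine (lintegral_congr fun w => ?_).trans lintegral_zero
      refine indicator_of_notMem ?_ _
      rintro ⟨a, b, c⟩
      exact hv ⟨a.trans b, c⟩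
  rw [hL, lintegral_lintegral_swap h2.aemeasurable, ← lintegral_indicator measurableSet_Ioo]
  refine lintegral_congr fun w => ?_
  by_cases hw : w ∈ Ioo u t
  · rw [indicator_of_mem hw]
    have h3 : (fun v => {r : ℝ × ℝ | u < r.2 ∧ r.2 < r.1 ∧ r.1 < t}.indicator
        (fun r => F r.1 r.2) (v, w)) = (Ioo w t).indicator fun v => F v w := by
      funext v
      by_cases hv : v ∈ Ioo w t
      · rw [indicator_of_mem hv, indicator_of_mem (show (v, w) ∈ {r : ℝ × ℝ | u < r.2 ∧ r.2 < r.1 ∧ r.1 < t} from ⟨hw.1, hv.1, hv.2⟩)]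
      · rw [indicator_of_notMem hv, indicator_of_notMem]
        rintro ⟨a, b, c⟩
        exact hv ⟨b, c⟩
    rw [h3, lintegral_indicator measurableSet_Ioo]
    simp only [hF]
    rw [lintegral_lintegral_swap]
    · refine lintegral_congr fun y => ?_
      exact lintegral_const_mul _ ((Q.measurable_Lf f hf n).comp (f := fun v : ℝ => (w, y, v))
        (by fun_prop))
    · refine Measurable.aemeasurable ?_
      exact (((Q.measurable_Lf f hf n).comp (f := fun s : ℝ × X => (w, s.2, s.1))
        (by fun_prop))).const_mul _
  · rw [indicator_of_notMem hw]
    refine (lintegral_congr fun v => ?_).trans lintegral_zero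
    refine indicator_of_notMem ?_ _
    rintro ⟨a, b, c⟩
    exact hw ⟨a, b.trans c⟩

section main

variable (Q : ConsQFun X T₀ T₁) (B : Set X)

/-- The indicator of `B`. -/
def fB (B : Set X) : ℝ × X → ℝ≥0∞ := fun p => B.indicator 1 p.2
/-- The rate restricted to `B`. -/
def fo (Q : ConsQFun X T₀ T₁) (B : Set X) : ℝ × X → ℝ≥0∞ :=
  fun p => B.indicator 1 p.2 * Q.qp p.2 p.1 univ
/-- The rate into `B`. -/
def fi (Q : ConsQFun X T₀ T₁) (B : Set X) : ℝ × X → ℝ≥0∞ := fun p => Q.qp p.2 p.1 B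

theorem measurable_fB (hB : MeasurableSet B) : Measurable (fB B) :=
  (measurable_one.indicator hB).comp measurable_snd
theorem measurable_fo (hB : MeasurableSet B) : Measurable (Q.fo B) :=
  (measurable_fB B hB).mul ((Q.meas univ .univ).comp measurable_swap)
theorem measurable_fi (hB : MeasurableSet B) : Measurable (Q.fi B) :=
  (Q.meas B hB).comp measurable_swap

theorem step_zero (hLB : Q.AssumptionLB) (u t : ℝ) (x : X)
    (hu : T₀ ≤ u) (hut : u ≤ t) (ht : (t : EReal) < T₁) :
    Q.Lf (fB B) 0 u x t + Q.Gf (Q.fo B) 0 u x t = B.indicator 1 x := by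
  simp only [Lf, Gf, fB, fo]
  by_cases hx : x ∈ B
  · simp only [indicator_of_mem hx, Pi.one_apply, mul_one, one_mul]
    exact Q.EE_add hLB u t x hu hut ht
  · simp [indicator_of_notMem hx]

theorem step_aux (hB : MeasurableSet B) (n : ℕ) (u t : ℝ) (x : X) :
    Q.Lf (fB B) (n + 1) u x t + Q.Gf (Q.fo B) (n + 1) u x t =
    ∫⁻ w in Ioo u t, ∫⁻ y, Q.EE u w x * (Q.Lf (fB B) n w y t + Q.Gf (Q.fo B) n w y t)
      ∂(Q.qp x w) := by
  rw [Q.Gf_succ _ (Q.measurable_fo B hB)]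
  simp only [Lf]
  rw [← lintegral_add_left (Q.measurable_Lf_inner _ (measurable_fB B hB) n u x t)]
  refine lintegral_congr fun w => ?_
  rw [← lintegral_add_left ((Q.measurable_Lf_y _ (measurable_fB B hB) n w t).const_mul _)]
  simp only [mul_add]

theorem step_succ (hLB : Q.AssumptionLB) (hB : MeasurableSet B) (t : ℝ) (ht : (t : EReal) < T₁)
    (n : ℕ) : ∀ (u : ℝ) (x : X), T₀ ≤ u → u ≤ t →
    Q.Lf (fB B) (n + 1) u x t + Q.Gf (Q.fo B) (n + 1) u x t = Q.Gf (Q.fi B) n u x t := by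
  induction n with
  | zero =>
    intro u x hu hut
    rw [Q.step_aux B hB, Gf]
    refine setLIntegral_congr_fun measurableSet_Ioo fun w hw => ?_
    have h : ∀ y, Q.Lf (fB B) 0 w y t + Q.Gf (Q.fo B) 0 w y t = B.indicator 1 y := fun y =>
      Q.step_zero B hLB w t y (hu.trans hw.1.le) hw.2.le ht
    simp only [h]
    simp only [Lf, fi]
    rw [lintegral_const_mul _ (measurable_one.indicator hB), lintegral_indicator_one hB]
  | succ n ih =>
    intro u x hu hut
    rw [Q.step_aux B hB, Q.Gf_succ _ (Q.measurable_fi B hB)]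
    refine setLIntegral_congr_fun measurableSet_Ioo fun w hw => ?_
    simp only [ih w _ (hu.trans hw.1.le) hw.2.le]

theorem Pbar_eq (u t : ℝ) (x : X) : Q.Pbar u x t B = ∑' n, Q.Lf (fB B) n u x t := by
  simp only [Pbar, Q.PbarN_eq]; rfl

theorem tsum_Gf (f : ℝ × X → ℝ≥0∞) (hf : Measurable f) (u t : ℝ) (x : X) :
    ∑' n, Q.Gf f n u x t = ∫⁻ v in Ioo u t, ∑' n, Q.Lf f n u x v := by
  rw [lintegral_tsum fun n => ?_]
  · rfl
  · exact ((Q.measurable_Lf f hf n).comp (f := fun v : ℝ => (u, x, v))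
      (by fun_prop)).aemeasurable

theorem forward_ennreal (hLB : Q.AssumptionLB) (hB : MeasurableSet B) (u t : ℝ) (x : X)
    (hu : T₀ ≤ u) (hut : u ≤ t) (ht : (t : EReal) < T₁) :
    Q.Pbar u x t B + ∫⁻ v in Ioo u t, ∑' n, Q.Lf (Q.fo B) n u x v =
      B.indicator 1 x + ∫⁻ v in Ioo u t, ∑' n, Q.Lf (Q.fi B) n u x v := by
  rw [Pbar_eq, ← Q.tsum_Gf _ (Q.measurable_fo B hB), ← Q.tsum_Gf _ (Q.measurable_fi B hB),
    ← ENNReal.tsum_add, tsum_eq_zero_add' ENNReal.summable, Q.step_zero B hLB u t x hu hut ht]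
  congr 1
  exact tsum_congr fun n => Q.step_succ B hLB hB t ht n u x hu hut

theorem sum_le_one (hLB : Q.AssumptionLB) (t : ℝ) (ht : (t : EReal) < T₁)
    (N : ℕ) : ∀ (u : ℝ) (x : X), T₀ ≤ u → u ≤ t →
    ∑ n ∈ Finset.range N, Q.Lf (fun _ => 1) n u x t ≤ 1 := by
  induction N with
  | zero => intro u x _ _; simp
  | succ N ih =>
    intro u x hu hut
    rw [Finset.sum_range_succ', add_comm]
    refine le_of_le_of_eq ?_ (Q.EE_add hLB u t x hu hut ht)
    refine add_le_add (by simp [Lf]) ?_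
    simp only [Lf]
    rw [← lintegral_finsetSum _
      (fun n _ => Q.measurable_Lf_inner _ measurable_const n u x t)]
    refine setLIntegral_mono' measurableSet_Ioo fun w hw => ?_
    rw [← lintegral_finsetSum _
      (fun n _ => (Q.measurable_Lf_y _ measurable_const n w t).const_mul _)]
    calc _ ≤ ∫⁻ y, Q.EE u w x ∂(Q.qp x w) := by
          refine lintegral_mono fun y => ?_
          simp only
          rw [← Finset.mul_sum]
          calc _ ≤ Q.EE u w x * 1 := mul_le_mul_right (ih w y (hu.trans hw.1.le) hw.2.le) _
            _ = _ := mul_one _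
      _ = _ := by simp

theorem tsum_le (hLB : Q.AssumptionLB) (u t : ℝ) (x : X) (c : ℝ≥0∞) (f : ℝ × X → ℝ≥0∞)
    (hf : ∀ z, f (t, z) ≤ c) (hu : T₀ ≤ u) (hut : u ≤ t) (ht : (t : EReal) < T₁) :
    ∑' n, Q.Lf f n u x t ≤ c := by
  have h1 : ∀ n, Q.Lf f n u x t ≤ c * Q.Lf (fun _ => 1) n u x t := by
    intro n
    rw [← Q.Lf_const_mul _ measurable_const,
      Q.Lf_congr f (fun p => f (t, p.2)) t (fun z => rfl) n u x]
    exact Q.Lf_mono _ _ (fun p => by simpa using hf p.2) n u x t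
  calc _ ≤ ∑' n, c * Q.Lf (fun _ => 1) n u x t := ENNReal.tsum_le_tsum h1
    _ = c * ∑' n, Q.Lf (fun _ => 1) n u x t := ENNReal.tsum_mul_left
    _ ≤ c * 1 := by
        refine mul_le_mul_right ?_ _
        rw [ENNReal.tsum_eq_iSup_nat]
        exact iSup_le fun N => Q.sum_le_one hLB t ht N u x hu hut
    _ = c := mul_one c

theorem Pbar_ne_top (hLB : Q.AssumptionLB) (u t : ℝ) (x : X)
    (hu : T₀ ≤ u) (hut : u ≤ t) (ht : (t : EReal) < T₁) : Q.Pbar u x t B ≠ ⊤ := by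
  rw [Pbar_eq]
  refine ((Q.tsum_le hLB u t x 1 (fB B) (fun z => ?_) hu hut ht).trans_lt
    ENNReal.one_lt_top).ne
  by_cases hz : z ∈ B <;> simp [fB, hz]

theorem fo_ne_top (hLB : Q.AssumptionLB) (hqB : Q.QBddOn T₁ B) (u t : ℝ) (x : X)
    (hu : T₀ ≤ u) (ht : (t : EReal) < T₁) :
    ∫⁻ v in Ioo u t, ∑' n, Q.Lf (Q.fo B) n u x v ≠ ⊤ := by
  obtain ⟨C, hC, hb⟩ := hqB
  refine (lt_of_le_of_lt (setLIntegral_mono' (g := fun _ => C) measurableSet_Ioo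
    fun v hv => ?_) ?_).ne
  · have hv1 : (v : EReal) < T₁ := lt_trans (by exact_mod_cast hv.2) ht
    refine Q.tsum_le hLB u v x C _ (fun z => ?_) hu hv.1.le hv1
    by_cases hz : z ∈ B
    · simpa [fo, hz] using hb z hz v (hu.trans hv.1.le) hv1
    · simp [fo, hz]
  · simp only [setLIntegral_const, Real.volume_Ioo]
    exact ENNReal.mul_lt_top hC.lt_top ENNReal.ofReal_lt_top

theorem integral_toReal_tsum (f : ℝ × X → ℝ≥0∞) (hf : Measurable f) (u t : ℝ) (x : X)
    (hut : u ≤ t) (ht : (t : EReal) < T₁) (hft : ∀ p, f p ≠ ⊤)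
    (hfin : ∫⁻ v in Ioo u t, ∑' n, Q.Lf f n u x v ≠ ⊤) (μ : ℝ → Measure X)
    (hμ : ∀ w : ℝ, u < w → (w : EReal) < T₁ → ∀ C : Set X, MeasurableSet C →
      μ w C = Q.Pbar u x w C) :
    ∫ w in u..t, (∫ y, (f (w, y)).toReal ∂(μ w)) =
      (∫⁻ v in Ioo u t, ∑' n, Q.Lf f n u x v).toReal := by
  have hm : Measurable fun v => ∑' n, Q.Lf f n u x v := Measurable.tsum fun n =>
    (Q.measurable_Lf f hf n).comp (f := fun v : ℝ => (u, x, v)) (by fun_prop)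
  rw [intervalIntegral.integral_of_le hut, integral_Ioc_eq_integral_Ioo,
    ← integral_toReal hm.aemeasurable (ae_lt_top hm hfin)]
  refine setIntegral_congr_fun measurableSet_Ioo fun w hw => ?_
  have hw1 : (w : EReal) < T₁ := lt_trans (by exact_mod_cast hw.2) ht
  rw [integral_toReal (f := fun y => f (w, y)) (hf.comp measurable_prodMk_left).aemeasurable
    (Eventually.of_forall fun y => (hft _).lt_top),
    Q.lintegral_eq_tsum u x w (μ w) (hμ w hw.1 hw1) f hf]

end main

end ConsQFun

/-- under Assumption LB, for all `u ∈ [T₀,T₁)`, `x ∈ X` and `q`-bounded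
Borel sets `B`, the transition function `P̄` satisfies, for all `t ∈ (u,T₁)`, the integral
form of Kolmogorov's forward equation
`P̄(u,x;t,B) = 1{x∈B} − ∫_u^t ∫_B q(y,w) P̄(u,x;w,dy) dw
  + ∫_u^t ∫_X q(y,w,B∖{y}) P̄(u,x;w,dy) dw`
(integration with respect to `P̄(u,x;w,dy)` being expressed via any measure `μ w` agreeing
with `P̄(u,x;w,·)` on Borel sets). -/
theorem pbar_integral_forward_equation
    {X : Type*} [MeasurableSpace X] [StandardBorelSpace X]
    {T₀ : ℝ} {T₁ : EReal} (hT : (T₀ : EReal) < T₁)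
    (Q : ConsQFun X T₀ T₁) (hLB : Q.AssumptionLB)
    (u : ℝ) (x : X) (B : Set X)
    (hu : T₀ ≤ u) (hu₁ : (u : EReal) < T₁)
    (hB : MeasurableSet B) (hqB : Q.QBddOn T₁ B)
    (μ : ℝ → Measure X)
    (hμ : ∀ w : ℝ, u < w → (w : EReal) < T₁ → ∀ C : Set X, MeasurableSet C →
      μ w C = Q.Pbar u x w C) :
    ∀ t : ℝ, u < t → (t : EReal) < T₁ →
      Q.PbarR u x t B =
        B.indicator (fun _ => (1 : ℝ)) x -
          (∫ w in u..t, (∫ y in B, Q.qrate y w ∂(μ w))) +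
          ∫ w in u..t, (∫ y, (Q.qp y w B).toReal ∂(μ w)) := by
  intro t hut ht
  have hkey := Q.forward_ennreal B hLB hB u t x hu hut.le ht
  have hP := Q.Pbar_ne_top B hLB u t x hu hut.le ht
  have hO := Q.fo_ne_top B hLB hqB u t x hu ht
  have hI : ∫⁻ v in Ioo u t, ∑' n, Q.Lf (Q.fi B) n u x v ≠ ⊤ := by
    intro h
    rw [h, add_top] at hkey
    exact ENNReal.add_ne_top.2 ⟨hP, hO⟩ hkey
  have hind : B.indicator (1 : X → ℝ≥0∞) x ≠ ⊤ := by
    by_cases hx : x ∈ B <;> simp [hx]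
  have hindR : (B.indicator (1 : X → ℝ≥0∞) x).toReal = B.indicator (fun _ => (1 : ℝ)) x := by
    by_cases hx : x ∈ B <;> simp [hx]
  have h1 := Q.integral_toReal_tsum (Q.fo B) (Q.measurable_fo B hB) u t x hut.le ht
    (fun p => by
      by_cases hx : p.2 ∈ B
      · simpa [ConsQFun.fo, hx] using Q.fin p.2 p.1
      · simp [ConsQFun.fo, hx]) hO μ hμ
  have h2 := Q.integral_toReal_tsum (Q.fi B) (Q.measurable_fi B hB) u t x hut.le ht
    (fun p => measure_ne_top _ _) hI μ hμ
  have h3 : ∀ w, ∫ y in B, Q.qrate y w ∂(μ w) = ∫ y, (Q.fo B (w, y)).toReal ∂(μ w) := by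
    intro w
    rw [← integral_indicator hB]
    refine integral_congr_ae (Eventually.of_forall fun y => ?_)
    by_cases hy : y ∈ B <;> simp [ConsQFun.fo, ConsQFun.qrate, hy]
  have h4 : ∀ w, ∫ y, (Q.qp y w B).toReal ∂(μ w) = ∫ y, (Q.fi B (w, y)).toReal ∂(μ w) :=
    fun w => rfl
  simp only [h3, h4, h1, h2]
  have h5 := congrArg ENNReal.toReal hkey
  rw [ENNReal.toReal_add hP hO, ENNReal.toReal_add hind hI, hindR] at h5
  rw [ConsQFun.PbarR]
  linarith
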